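/- arXiv:2004.06075 — 7 statements merged into one kernel-verified Lean document; each statement's English description precedes it below -/
import Mathlib

section
/- Let K be a field, A a simple associative (possibly non-unital) K-algebra, and u ∈ A a nonzero idempotent. Then C_u is a field with unit u. More precisely: C_u is a K-linear subspace of A contained in the corner uAu, it is closed under multiplication, it contains u, any two elements of C_u commute, and for every nonzero x ∈ C_u there exists y ∈ C_u with x·y = y·x = u. -/
/-- A centralizer of a (possibly non-unital) associative `K`-algebra `A`. -/
def IsCentralizer {K A : Type*} [Field K] [NonUnitalRing A] [Module K A]
    (τ : A →ₗ[K] A) : Prop :=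
  ∀ x y : A, τ (x * y) = τ x * y ∧ τ (x * y) = x * τ y

/-- `C_u = {τ(u) : τ a centralizer of A}`. -/
def centroidValues (K : Type*) {A : Type*} [Field K] [NonUnitalRing A] [Module K A]
    (u : A) : Set A :=
  {x | ∃ τ : A →ₗ[K] A, IsCentralizer τ ∧ τ u = x}

/-- A (possibly non-unital) associative `K`-algebra is simple if `A·A ≠ 0` and its only
two-sided (algebra) ideals are `0` and `A`. -/
def IsSimpleAlgebra (K A : Type*) [Field K] [NonUnitalRing A] [Module K A] : Prop :=
  (∃ x y : A, x * y ≠ 0) ∧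
  ∀ I : Submodule K A, (∀ a : A, ∀ x ∈ I, a * x ∈ I ∧ x * a ∈ I) → I = ⊥ ∨ I = ⊤

namespace IsCentralizer

variable {K A : Type*} [Field K] [NonUnitalRing A] [Module K A] {τ σ : A →ₗ[K] A}

theorem id : IsCentralizer (LinearMap.id : A →ₗ[K] A) := fun _ _ => ⟨rfl, rfl⟩

theorem add (hτ : IsCentralizer τ) (hσ : IsCentralizer σ) : IsCentralizer (τ + σ) := fun x y =>
  ⟨by simp only [LinearMap.add_apply, (hτ x y).1, (hσ x y).1, add_mul],
    by simp only [LinearMap.add_apply, (hτ x y).2, (hσ x y).2, mul_add]⟩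

theorem smul [SMulCommClass K A A] [IsScalarTower K A A] (k : K) (hτ : IsCentralizer τ) :
    IsCentralizer (k • τ) := fun x y =>
  ⟨by simp only [LinearMap.smul_apply, (hτ x y).1, smul_mul_assoc],
    by simp only [LinearMap.smul_apply, (hτ x y).2, mul_smul_comm]⟩

theorem comp (hτ : IsCentralizer τ) (hσ : IsCentralizer σ) : IsCentralizer (τ ∘ₗ σ) := fun x y =>
  ⟨by simp only [LinearMap.comp_apply, (hσ x y).1, (hτ _ y).1],
    by simp only [LinearMap.comp_apply, (hσ x y).2, (hτ x _).2]⟩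

theorem symm {e : A ≃ₗ[K] A} (he : IsCentralizer (e : A →ₗ[K] A)) :
    IsCentralizer (e.symm : A →ₗ[K] A) := fun x y => by
  have h₁ := (he (e.symm x) y).1
  have h₂ := (he x (e.symm y)).2
  simp only [LinearEquiv.coe_coe, LinearEquiv.apply_symm_apply] at h₁ h₂ ⊢
  exact ⟨e.symm_apply_eq.2 h₁.symm, e.symm_apply_eq.2 h₂.symm⟩

/-- **Schur's lemma** for centralizers of a simple algebra. -/
theorem bijective (hA : IsSimpleAlgebra K A) (hτ : IsCentralizer τ) (h0 : τ ≠ 0) :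
    Function.Bijective τ := by
  constructor
  · refine LinearMap.ker_eq_bot.1 ((hA.2 (LinearMap.ker τ) fun a x hx => ?_).resolve_right
      fun h => h0 (LinearMap.ker_eq_top.1 h))
    rw [LinearMap.mem_ker] at hx
    simp only [LinearMap.mem_ker]
    exact ⟨by rw [(hτ a x).2, hx, mul_zero], by rw [(hτ x a).1, hx, zero_mul]⟩
  · refine LinearMap.range_eq_top.1 ((hA.2 (LinearMap.range τ) ?_).resolve_left
      fun h => h0 (LinearMap.range_eq_bot.1 h))
    rintro a _ ⟨x, rfl⟩
    exact ⟨⟨a * x, (hτ a x).2⟩, ⟨x * a, (hτ x a).1⟩⟩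

theorem mul_apply_idempotent {u : A} (hu : u * u = u) (hτ : IsCentralizer τ) : u * τ u = τ u := by
  rw [← (hτ u u).2, hu]

theorem apply_mul_idempotent {u : A} (hu : u * u = u) (hτ : IsCentralizer τ) : τ u * u = τ u := by
  rw [← (hτ u u).1, hu]

theorem apply_mul_apply {u : A} (hu : u * u = u) (hτ : IsCentralizer τ) (hσ : IsCentralizer σ) :
    τ u * σ u = τ (σ u) := by
  rw [← (hτ u (σ u)).1, hσ.mul_apply_idempotent hu]

theorem apply_mul_apply' {u : A} (hu : u * u = u) (hτ : IsCentralizer τ) (hσ : IsCentralizer σ) :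
    τ u * σ u = σ (τ u) := by
  rw [← (hσ (τ u) u).2, hτ.apply_mul_idempotent hu]

end IsCentralizer

/-- For a simple associative `K`-algebra `A` and a nonzero idempotent `u`, the set
`C_u` is a field with unit `u`: it is a `K`-subspace of `A` contained in the corner
`uAu`, closed under multiplication, contains `u`, is commutative, and every nonzero
element has an inverse relative to the unit `u`. -/
theorem centroidValues_isField
    {K A : Type*} [Field K] [NonUnitalRing A] [Module K A]
    [SMulCommClass K A A] [IsScalarTower K A A]
    (hA : IsSimpleAlgebra K A)
    (u : A) (hu : u * u = u) (hu0 : u ≠ 0) :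
    (∀ x ∈ centroidValues K u, ∃ a : A, x = u * a * u) ∧
    (∀ x ∈ centroidValues K u, ∀ y ∈ centroidValues K u, x + y ∈ centroidValues K u) ∧
    (∀ (k : K), ∀ x ∈ centroidValues K u, k • x ∈ centroidValues K u) ∧
    (∀ x ∈ centroidValues K u, ∀ y ∈ centroidValues K u, x * y ∈ centroidValues K u) ∧
    (u ∈ centroidValues K u) ∧
    (∀ x ∈ centroidValues K u, ∀ y ∈ centroidValues K u, x * y = y * x) ∧
    (∀ x ∈ centroidValues K u, x ≠ 0 →
      ∃ y ∈ centroidValues K u, x * y = u ∧ y * x = u) := by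
  refine ⟨?_, ?_, ?_, ?_, ⟨LinearMap.id, .id, rfl⟩, ?_, ?_⟩
  · rintro _ ⟨τ, hτ, rfl⟩
    exact ⟨τ u, by rw [hτ.mul_apply_idempotent hu, hτ.apply_mul_idempotent hu]⟩
  · rintro _ ⟨τ, hτ, rfl⟩ _ ⟨σ, hσ, rfl⟩
    exact ⟨τ + σ, hτ.add hσ, rfl⟩
  · rintro k _ ⟨τ, hτ, rfl⟩
    exact ⟨k • τ, hτ.smul k, rfl⟩
  · rintro _ ⟨τ, hτ, rfl⟩ _ ⟨σ, hσ, rfl⟩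
    exact ⟨τ ∘ₗ σ, hτ.comp hσ, (hτ.apply_mul_apply hu hσ).symm⟩
  · rintro _ ⟨τ, hτ, rfl⟩ _ ⟨σ, hσ, rfl⟩
    rw [hτ.apply_mul_apply' hu hσ, hσ.apply_mul_apply hu hτ]
  · rintro _ ⟨τ, hτ, rfl⟩ hx
    have hτ0 : τ ≠ 0 := by
      rintro rfl
      exact hx rfl
    let e : A ≃ₗ[K] A := LinearEquiv.ofBijective τ (hτ.bijective hA hτ0)
    have he : IsCentralizer (e.symm : A →ₗ[K] A) := IsCentralizer.symm (e := e) hτ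
    refine ⟨e.symm u, ⟨_, he, rfl⟩, ?_, ?_⟩
    · exact (hτ.apply_mul_apply hu he).trans (e.apply_symm_apply u)
    · exact (he.apply_mul_apply hu hτ).trans (e.symm_apply_apply u)
end

section
/- Let K be a field, A a simple associative (possibly non-unital) K-algebra, and u ∈ A an idempotent. If x ∈ C_u and y ∈ uAu with x ≠ 0 and y ≠ 0, then x·y ≠ 0. -/
/-- The kernel of a nonzero centralizer of a simple algebra is trivial. -/
theorem IsCentralizer.ker_eq_bot {K A : Type*} [Field K] [NonUnitalRing A] [Module K A]
    (hA : IsSimpleAlgebra K A) {τ : A →ₗ[K] A} (hτ : IsCentralizer τ) (hτ0 : τ ≠ 0) :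
    LinearMap.ker τ = ⊥ := by
  refine (hA.2 (LinearMap.ker τ) fun a x hx ↦ ?_).resolve_right fun h ↦
    hτ0 (LinearMap.ker_eq_top.mp h)
  rw [LinearMap.mem_ker] at hx
  simp [(hτ a x).2, (hτ x a).1, hx]

/-- In a simple associative `K`-algebra `A` with idempotent `u`, if `x ∈ C_u` and
`y ∈ uAu` are both nonzero, then `x·y ≠ 0`. -/
theorem mul_ne_zero_of_centroidValue_simple
    {K A : Type*} [Field K] [NonUnitalRing A] [Module K A]
    [SMulCommClass K A A] [IsScalarTower K A A]
    (hA : IsSimpleAlgebra K A)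
    (u : A) (hu : u * u = u)
    (x y : A) (hx : x ∈ centroidValues K u) (hy : ∃ a : A, y = u * a * u)
    (hx0 : x ≠ 0) (hy0 : y ≠ 0) :
    x * y ≠ 0 := by
  obtain ⟨τ, hτ, rfl⟩ := hx
  obtain ⟨a, rfl⟩ := hy
  have hτ0 : τ ≠ 0 := by
    rintro rfl
    exact hx0 rfl
  have huy : u * (u * a * u) = u * a * u := by
    simp only [← mul_assoc, hu]
  rw [← (hτ u (u * a * u)).1, huy]
  exact fun h ↦ hy0 ((LinearMap.ker_eq_bot'.mp (hτ.ker_eq_bot hA hτ0)) _ h)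
end

section
/- Let A be a prime (possibly non-unital) ring and u ∈ A an idempotent. If x ∈ C_u and y ∈ uAu with x ≠ 0 and y ≠ 0, then x·y ≠ 0. -/
/-- A centralizer of a (possibly non-unital) ring `A`: an additive map `τ : A → A`
with `τ (x*y) = τ x * y = x * τ y` for all `x y`. -/
def IsAddCentralizer {A : Type*} [NonUnitalRing A] (τ : A →+ A) : Prop :=
  ∀ x y : A, τ (x * y) = τ x * y ∧ τ (x * y) = x * τ y

/-- A (possibly non-unital) ring `A` is prime if `a·x·b = 0` for all `x` implies
`a = 0` or `b = 0`. -/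
def IsPrimeNonUnitalRing (A : Type*) [NonUnitalRing A] : Prop :=
  ∀ a b : A, (∀ x : A, a * x * b = 0) → a = 0 ∨ b = 0

/-- In a prime (possibly non-unital) ring `A` with idempotent `u`, if `x ∈ C_u` and
`y ∈ uAu` are both nonzero, then `x·y ≠ 0`. -/
theorem mul_ne_zero_of_centroidValue_prime
    {A : Type*} [NonUnitalRing A] (hA : IsPrimeNonUnitalRing A)
    (u : A) (hu : u * u = u)
    (x y : A)
    (hx : ∃ τ : A →+ A, IsAddCentralizer τ ∧ τ u = x)
    (hy : ∃ a : A, y = u * a * u)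
    (hx0 : x ≠ 0) (hy0 : y ≠ 0) :
    x * y ≠ 0 := by
  obtain ⟨τ, hτ, rfl⟩ := hx
  obtain ⟨a, rfl⟩ := hy
  intro h
  have hτy : τ (u * a * u) = 0 := by
    rw [← (hτ _ _).1] at h
    simpa only [← mul_assoc, hu] using h
  refine (hA _ _ fun z => ?_).elim hx0 hy0
  rw [← (hτ u z).1, ← (hτ (u * z) _).1, (hτ (u * z) _).2, hτy, mul_zero]
end

section
/- Let K be a field, A a prime associative (possibly non-unital) K-algebra, and u ∈ A a nonzero idempotent. Then the evaluation map Ω : 𝒞(A) → A, Ω(τ) := τ(u), is injective, K-linear, satisfies Ω(τ ∘ σ) = Ω(τ)·Ω(σ) for all centralizers τ, σ, and sends the identity centralizer to u; its image is C_u, which is contained in the center of the corner uAu. Consequently Ω is an isomorphism of K-algebras from the centroid 𝒞(A) onto C_u (viewed as a K-algebra with multiplication inherited from A and unit u). -/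
namespace IsCentralizer

variable {K A : Type*} [Field K] [NonUnitalRing A] [Module K A] {τ σ : A →ₗ[K] A}

theorem map_mul_left (hτ : IsCentralizer τ) (x y : A) : τ (x * y) = τ x * y :=
  (hτ x y).1

theorem map_mul_right (hτ : IsCentralizer τ) (x y : A) : τ (x * y) = x * τ y :=
  (hτ x y).2

theorem sub (hτ : IsCentralizer τ) (hσ : IsCentralizer σ) : IsCentralizer (τ - σ) := by
  intro x y
  simp only [LinearMap.sub_apply, sub_mul, mul_sub]
  exact ⟨by rw [hτ.map_mul_left, hσ.map_mul_left], by rw [hτ.map_mul_right, hσ.map_mul_right]⟩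

/-- On a prime algebra, a centralizer vanishing at a nonzero element is zero. -/
theorem eq_zero_of_apply_eq_zero (hA : IsPrimeNonUnitalRing A) (hτ : IsCentralizer τ) {u : A}
    (hu0 : u ≠ 0) (h : τ u = 0) : τ = 0 := by
  ext a
  refine (hA u (τ a) fun x => ?_).resolve_left hu0
  rw [← hτ.map_mul_right, mul_assoc, hτ.map_mul_left, h, zero_mul]

/-- On a prime algebra, a centralizer is determined by its value at a nonzero element. -/
theorem eq_of_apply_eq (hA : IsPrimeNonUnitalRing A) (hτ : IsCentralizer τ)
    (hσ : IsCentralizer σ) {u : A} (hu0 : u ≠ 0) (h : τ u = σ u) : τ = σ :=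
  sub_eq_zero.mp <| (hτ.sub hσ).eq_zero_of_apply_eq_zero hA hu0 <| by
    rw [LinearMap.sub_apply, h, sub_self]

theorem comp_apply_idempotent (hτ : IsCentralizer τ) (hσ : IsCentralizer σ) {u : A}
    (hu : u * u = u) : (τ ∘ₗ σ) u = τ u * σ u := by
  rw [LinearMap.comp_apply, ← hτ.map_mul_left, ← hσ.map_mul_right, hu]

theorem corner_apply (hτ : IsCentralizer τ) {u : A} (hu : u * u = u) : u * τ u * u = τ u := by
  rw [← hτ.map_mul_right, hu, ← hτ.map_mul_left, hu]

theorem apply_mul_corner_comm (hτ : IsCentralizer τ) {u : A} (hu : u * u = u) (a : A) :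
    τ u * (u * a * u) = u * a * u * τ u := by
  rw [← hτ.map_mul_left, ← hτ.map_mul_right, mul_assoc (u * a), hu, mul_assoc u a,
    ← mul_assoc u u, hu]

end IsCentralizer

/-- For a prime associative `K`-algebra `A` and a nonzero idempotent `u`, the
evaluation map `Ω : 𝒞(A) → A`, `Ω(τ) = τ(u)`, is an injective, `K`-linear, unital and
multiplicative map whose image is `C_u`, and `C_u` lies in the center of the corner
`uAu`; hence `Ω` is a `K`-algebra isomorphism from the centroid onto `C_u`. -/
theorem centroid_eval_isomorphism
    {K A : Type*} [Field K] [NonUnitalRing A] [Module K A]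
    [SMulCommClass K A A] [IsScalarTower K A A]
    (hA : IsPrimeNonUnitalRing A)
    (u : A) (hu : u * u = u) (hu0 : u ≠ 0) :
    -- Ω is injective on centralizers
    (∀ τ σ : A →ₗ[K] A, IsCentralizer τ → IsCentralizer σ → τ u = σ u → τ = σ) ∧
    -- Ω is additive and K-homogeneous
    (∀ τ σ : A →ₗ[K] A, (τ + σ) u = τ u + σ u) ∧
    (∀ (k : K) (τ : A →ₗ[K] A), (k • τ) u = k • τ u) ∧
    -- Ω is multiplicative (composition goes to product in A)
    (∀ τ σ : A →ₗ[K] A, IsCentralizer τ → IsCentralizer σ → (τ ∘ₗ σ) u = τ u * σ u) ∧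
    -- Ω sends the identity centralizer to u
    ((LinearMap.id : A →ₗ[K] A) u = u ∧ IsCentralizer (LinearMap.id : A →ₗ[K] A)) ∧
    -- the image of Ω is C_u, which lies in the center of the corner uAu
    ({x : A | ∃ τ : A →ₗ[K] A, IsCentralizer τ ∧ τ u = x} = centroidValues K u) ∧
    (∀ x ∈ centroidValues K u,
      u * x * u = x ∧ ∀ a : A, x * (u * a * u) = (u * a * u) * x) := by
  refine ⟨fun τ σ hτ hσ h => hτ.eq_of_apply_eq hA hσ hu0 h, fun _ _ => rfl, fun _ _ => rfl,
    fun τ σ hτ hσ => hτ.comp_apply_idempotent hσ hu, ⟨rfl, IsCentralizer.id⟩, rfl, ?_⟩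
  rintro _ ⟨τ, hτ, rfl⟩
  exact ⟨hτ.corner_apply hu, hτ.apply_mul_corner_comm hu⟩
end

section
/- Let K be a field, A a unital associative K-algebra, B an associative (possibly non-unital) K-algebra, and i : A → B a nice embedding; set e := i(1_A). Then for every centralizer τ of B there is a unique map S : A → A satisfying i(S(a)) = e·τ(i(a))·e for all a ∈ A; this S is a centralizer of A, and the resulting map σ : 𝒞(B) → 𝒞(A), σ(τ) := S, is a unital K-algebra homomorphism: σ is K-linear and additive, σ(id_B) = id_A, and σ(τ ∘ τ′) = σ(τ) ∘ σ(τ′) for all centralizers τ, τ′ of B. -/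
/-- A nice embedding of a unital `K`-algebra `A` into a (possibly non-unital)
`K`-algebra `B`: an injective (not necessarily unital) algebra homomorphism `i`
whose image is the Peirce corner `i(1)·B·i(1)`. -/
def IsNiceEmbedding {K A B : Type*} [Field K] [Ring A] [Algebra K A]
    [NonUnitalRing B] [Module K B] (i : A →ₙₐ[K] B) : Prop :=
  Function.Injective i ∧ Set.range i = {z : B | ∃ b : B, z = i 1 * b * i 1}

theorem IsCentralizer.corner_apply_s6 {K A B : Type*} [Field K] [Ring A] [Algebra K A]
    [NonUnitalRing B] [Module K B] {τ : B →ₗ[K] B} (hτ : IsCentralizer τ)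
    (i : A →ₙₐ[K] B) (a : A) : i 1 * τ (i a) * i 1 = τ (i a) := by
  rw [← (hτ (i 1) (i a)).2, ← (hτ (i 1 * i a) (i 1)).1, ← map_mul, ← map_mul, one_mul, mul_one]

/-- The map on `A` induced by a centralizer of `B` through a nice embedding. -/
theorem IsNiceEmbedding.exists_linearMap_apply_eq {K A B : Type*} [Field K] [Ring A] [Algebra K A]
    [NonUnitalRing B] [Module K B] {i : A →ₙₐ[K] B} (hi : IsNiceEmbedding i)
    {τ : B →ₗ[K] B} (hτ : IsCentralizer τ) :
    ∃ S : A →ₗ[K] A, ∀ a, i (S a) = τ (i a) := by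
  have hmem (a : A) : τ (i a) ∈ Set.range i :=
    hi.2 ▸ ⟨τ (i a), (hτ.corner_apply_s6 i a).symm⟩
  choose S hS using hmem
  exact ⟨{ toFun := S
           map_add' := fun a b => hi.1 (by simp [hS])
           map_smul' := fun k a => hi.1 (by simp [hS]) }, hS⟩

/-- A nice embedding `i : A → B` induces, for each centralizer `τ` of `B`, a unique
map `S : A → A` with `i (S a) = i 1 * τ (i a) * i 1`; this `S` is a centralizer of
`A`, and the induced map `σ : 𝒞(B) → 𝒞(A)`, `σ(τ) = S`, is a unital `K`-algebra
homomorphism. -/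
theorem niceEmbedding_induces_centroid_hom
    {K A B : Type*} [Field K] [Ring A] [Algebra K A]
    [NonUnitalRing B] [Module K B] [SMulCommClass K B B] [IsScalarTower K B B]
    (i : A →ₙₐ[K] B) (hi : IsNiceEmbedding i) :
    -- existence and uniqueness of σ(τ)
    (∀ τ : B →ₗ[K] B, IsCentralizer τ →
      ∃! S : A →ₗ[K] A, ∀ a : A, i (S a) = i 1 * τ (i a) * i 1) ∧
    -- σ(τ) is a centralizer of A
    (∀ (τ : B →ₗ[K] B) (S : A →ₗ[K] A), IsCentralizer τ →
      (∀ a : A, i (S a) = i 1 * τ (i a) * i 1) → IsCentralizer S) ∧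
    -- σ(id_B) = id_A
    (∀ a : A, i ((LinearMap.id : A →ₗ[K] A) a)
        = i 1 * (LinearMap.id : B →ₗ[K] B) (i a) * i 1) ∧
    -- σ is additive
    (∀ (τ τ' : B →ₗ[K] B) (S S' : A →ₗ[K] A),
      IsCentralizer τ → IsCentralizer τ' →
      (∀ a : A, i (S a) = i 1 * τ (i a) * i 1) →
      (∀ a : A, i (S' a) = i 1 * τ' (i a) * i 1) →
      ∀ a : A, i ((S + S') a) = i 1 * (τ + τ') (i a) * i 1) ∧
    -- σ is K-homogeneous
    (∀ (k : K) (τ : B →ₗ[K] B) (S : A →ₗ[K] A), IsCentralizer τ →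
      (∀ a : A, i (S a) = i 1 * τ (i a) * i 1) →
      ∀ a : A, i ((k • S) a) = i 1 * (k • τ) (i a) * i 1) ∧
    -- σ is multiplicative: σ(τ ∘ τ') = σ(τ) ∘ σ(τ')
    (∀ (τ τ' : B →ₗ[K] B) (S S' : A →ₗ[K] A),
      IsCentralizer τ → IsCentralizer τ' →
      (∀ a : A, i (S a) = i 1 * τ (i a) * i 1) →
      (∀ a : A, i (S' a) = i 1 * τ' (i a) * i 1) →
      ∀ a : A, i ((S ∘ₗ S') a) = i 1 * (τ ∘ₗ τ') (i a) * i 1) := by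
  refine ⟨fun τ hτ => ?_, fun τ S hτ hS x y => ?_, fun a => ?_, fun τ τ' S S' _ _ hS hS' a => ?_,
    fun k τ S _ hS a => ?_, fun τ τ' S S' hτ hτ' hS hS' a => ?_⟩
  · obtain ⟨S, hS⟩ := hi.exists_linearMap_apply_eq hτ
    refine ⟨S, fun a => (hS a).trans (hτ.corner_apply_s6 i a).symm, fun T hT => ?_⟩
    ext a
    exact hi.1 ((hT a).trans ((hτ.corner_apply_s6 i a).trans (hS a).symm))
  · simp only [hτ.corner_apply_s6 i] at hS
    constructor <;> apply hi.1 <;> simp only [hS, map_mul]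
    · exact (hτ _ _).1
    · exact (hτ _ _).2
  · simp [← map_mul]
  · simp [hS, hS', mul_add, add_mul]
  · simp [hS, mul_smul_comm, smul_mul_assoc]
  · simp only [LinearMap.comp_apply, hS]
    rw [hS', hτ'.corner_apply_s6 i]
end

section
/- Let K be a field, B an associative (possibly non-unital) K-algebra, (I, ≤) a directed preordered set, and (e_i)_{i∈I} a family of idempotents of B such that e_i·e_j = e_j·e_i = e_i whenever i ≤ j, and such that every element of B lies in some corner e_i·B·e_i := {e_i·b·e_i : b ∈ B}. Then: (a) every centralizer τ of B maps each corner e_i·B·e_i into itself, and its restriction τ_i is a centralizer of the K-algebra e_i·B·e_i; (b) for i ≤ j, every centralizer of e_j·B·e_j maps e_i·B·e_i into itself and restricts to a centralizer of e_i·B·e_i; (c) the map sending τ ∈ 𝒞(B) to the family (τ_i)_{i∈I} of its restrictions is a bijection from 𝒞(B) onto the set of compatible families {(τ_i)_{i∈I} : τ_i ∈ 𝒞(e_i·B·e_i) and the restriction of τ_j to e_i·B·e_i equals τ_i whenever i ≤ j}, and this bijection is additive and multiplicative, i.e. it is an isomorphism of K-algebras from 𝒞(B) onto the inverse limit lim←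 𝒞(e_i·B·e_i) (with componentwise operations on compatible families). -/
/-- The `K`-linear compression `x ↦ e * x * e` onto the corner `eAe`. -/
noncomputable def cornerCompress {K A : Type*} [Field K] [NonUnitalRing A] [Module K A]
    [SMulCommClass K A A] [IsScalarTower K A A] (e : A) : A →ₗ[K] A :=
  (LinearMap.mulLeft K e).comp (LinearMap.mulRight K e)

/-- A centralizer of the corner algebra `eAe`, encoded as the `K`-linear map on `A`
obtained by extending through the canonical compression: it takes values in the
corner, factors through the compression, and satisfies the centralizer identities on
corner elements. -/
def IsCornerCentralizer {K A : Type*} [Field K] [NonUnitalRing A] [Module K A]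
    (e : A) (T : A →ₗ[K] A) : Prop :=
  (∀ x : A, e * T x * e = T x) ∧
  (∀ x : A, T (e * x * e) = T x) ∧
  (∀ x y : A, e * x * e = x → e * y * e = y →
    T (x * y) = T x * y ∧ T (x * y) = x * T y)

theorem cornerCompress_apply {K A : Type*} [Field K] [NonUnitalRing A] [Module K A]
    [SMulCommClass K A A] [IsScalarTower K A A] (e x : A) :
    cornerCompress (K := K) e x = e * x * e := by
  simp [cornerCompress, mul_assoc]

theorem corner_left {A : Type*} [NonUnitalRing A] {e x : A} (he : e * e = e)
    (hx : e * x * e = x) : e * x = x := by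
  rw [← hx, ← mul_assoc, ← mul_assoc, he]

theorem corner_right {A : Type*} [NonUnitalRing A] {e x : A} (he : e * e = e)
    (hx : e * x * e = x) : x * e = x := by
  rw [← hx, mul_assoc, he]

theorem corner_compress_mem {A : Type*} [NonUnitalRing A] {e : A} (he : e * e = e) (x : A) :
    e * (e * x * e) * e = e * x * e := by
  rw [← mul_assoc, ← mul_assoc, he, mul_assoc, he]

theorem corner_mono {A : Type*} [NonUnitalRing A] {e f x : A} (hef : e * f = e)
    (hfe : f * e = e) (hx : e * x * e = x) : f * x * f = x := by
  rw [← hx, ← mul_assoc, ← mul_assoc, hfe, mul_assoc, hef]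

theorem corner_mul_mem {A : Type*} [NonUnitalRing A] {e x y : A} (he : e * e = e)
    (hx : e * x * e = x) (hy : e * y * e = y) : e * (x * y) * e = x * y := by
  rw [← mul_assoc, corner_left he hx, mul_assoc, corner_right he hy]

/-- A linear map satisfying the centralizer identities on the corner of an idempotent
preserves that corner. -/
theorem corner_map_mem {K A : Type*} [Field K] [NonUnitalRing A] [Module K A]
    {e : A} (he : e * e = e) {T : A →ₗ[K] A}
    (hT : ∀ x y : A, e * x * e = x → e * y * e = y →
      T (x * y) = T x * y ∧ T (x * y) = x * T y)
    {x : A} (hx : e * x * e = x) : e * T x * e = T x := by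
  have hee : e * e * e = e := by rw [he, he]
  rw [← (hT e x hee hx).2, corner_left he hx, ← (hT x e hx hee).1, corner_right he hx]

/-- A linear map satisfying the centralizer identities on the corner of an idempotent
restricts to a centralizer of that corner. -/
theorem isCornerCentralizer_compress {K A : Type*} [Field K] [NonUnitalRing A] [Module K A]
    [SMulCommClass K A A] [IsScalarTower K A A] {e : A} (he : e * e = e) {T : A →ₗ[K] A}
    (hT : ∀ x y : A, e * x * e = x → e * y * e = y →
      T (x * y) = T x * y ∧ T (x * y) = x * T y) :
    IsCornerCentralizer e ((cornerCompress e).comp (T.comp (cornerCompress e))) := by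
  refine ⟨fun x => ?_, fun x => ?_, fun x y hx hy => ?_⟩
  · simp only [LinearMap.comp_apply, cornerCompress_apply, corner_compress_mem he]
  · simp only [LinearMap.comp_apply, cornerCompress_apply, corner_compress_mem he]
  · have hxy := corner_mul_mem he hx hy
    simp only [LinearMap.comp_apply, cornerCompress_apply, hx, hy, hxy,
      corner_map_mem he hT hx, corner_map_mem he hT hy, corner_map_mem he hT hxy]
    exact hT x y hx hy

/-- Let `B` be a (possibly non-unital) associative `K`-algebra which is the directed
union of the corners `e i · B · e i` of a compatible directed family of idempotents
`(e i)`.  Then every centralizer of `B` restricts to a centralizer of each corner,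
centralizers of bigger corners restrict to centralizers of smaller corners, and the
restriction map is a `K`-algebra isomorphism from `𝒞(B)` onto the inverse limit of
the centroids of the corners (i.e. onto the compatible families). -/
theorem centroid_directed_union_of_corners
    {K B : Type*} [Field K] [NonUnitalRing B] [Module K B]
    [SMulCommClass K B B] [IsScalarTower K B B]
    {I : Type*} [Preorder I]
    (hdir : ∀ i j : I, ∃ k : I, i ≤ k ∧ j ≤ k)
    (e : I → B)
    (hidem : ∀ i, e i * e i = e i)
    (hle : ∀ i j, i ≤ j → e i * e j = e i ∧ e j * e i = e i)
    (hcover : ∀ x : B, ∃ i, e i * x * e i = x) :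
    -- (a) every centralizer of B preserves each corner and restricts to a
    -- centralizer of the corner algebra
    (∀ τ : B →ₗ[K] B, IsCentralizer τ → ∀ i : I,
      (∀ x : B, e i * x * e i = x → e i * τ x * e i = τ x) ∧
      IsCornerCentralizer (e i)
        ((cornerCompress (e i)).comp (τ.comp (cornerCompress (e i))))) ∧
    -- (b) for i ≤ j, every centralizer of the corner at j preserves the corner at i
    -- and restricts to a centralizer of it
    (∀ i j : I, i ≤ j → ∀ T : B →ₗ[K] B, IsCornerCentralizer (e j) T →
      (∀ x : B, e i * x * e i = x → e i * T x * e i = T x) ∧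
      IsCornerCentralizer (e i)
        ((cornerCompress (e i)).comp (T.comp (cornerCompress (e i))))) ∧
    -- (c) injectivity of the restriction map
    (∀ τ τ' : B →ₗ[K] B, IsCentralizer τ → IsCentralizer τ' →
      (∀ (i : I) (x : B), e i * x * e i = x → τ x = τ' x) → τ = τ') ∧
    -- (c) surjectivity onto the compatible families (the inverse limit)
    (∀ F : I → (B →ₗ[K] B),
      (∀ i, IsCornerCentralizer (e i) (F i)) →
      (∀ i j, i ≤ j → ∀ x : B, e i * x * e i = x → F j x = F i x) →
      ∃ τ : B →ₗ[K] B, IsCentralizer τ ∧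
        ∀ (i : I) (x : B), e i * x * e i = x → τ x = F i x) ∧
    -- (c) the restriction map is additive
    (∀ τ τ' : B →ₗ[K] B, IsCentralizer τ → IsCentralizer τ' → ∀ i : I,
      (cornerCompress (e i)).comp ((τ + τ').comp (cornerCompress (e i))) =
        (cornerCompress (e i)).comp (τ.comp (cornerCompress (e i))) +
        (cornerCompress (e i)).comp (τ'.comp (cornerCompress (e i)))) ∧
    -- (c) the restriction map is multiplicative
    (∀ τ τ' : B →ₗ[K] B, IsCentralizer τ → IsCentralizer τ' → ∀ i : I,
      (cornerCompress (e i)).comp ((τ ∘ₗ τ').comp (cornerCompress (e i))) =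
        ((cornerCompress (e i)).comp (τ.comp (cornerCompress (e i)))) ∘ₗ
        ((cornerCompress (e i)).comp (τ'.comp (cornerCompress (e i))))) := by
  have hcorner : ∀ {i j : I}, i ≤ j → ∀ {x : B}, e i * x * e i = x → e j * x * e j = x :=
    fun hij _ hx => corner_mono (hle _ _ hij).1 (hle _ _ hij).2 hx
  refine ⟨fun τ hτ i => ?_, fun i j hij T hT => ?_, fun τ τ' _ _ h => ?_, fun F hF hcomp => ?_,
    fun τ τ' _ _ i => ?_, fun τ τ' _ hτ' i => ?_⟩
  · have h := fun x y (_ : e i * x * e i = x) (_ : e i * y * e i = y) => hτ x y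
    exact ⟨fun x => corner_map_mem (hidem i) h, isCornerCentralizer_compress (hidem i) h⟩
  · have h := fun x y (hx : e i * x * e i = x) (hy : e i * y * e i = y) =>
      hT.2.2 x y (hcorner hij hx) (hcorner hij hy)
    exact ⟨fun x => corner_map_mem (hidem i) h, isCornerCentralizer_compress (hidem i) h⟩
  · ext x
    obtain ⟨i, hi⟩ := hcover x
    exact h i x hi
  · choose c hc using hcover
    have hval : ∀ (i : I) (x : B), e i * x * e i = x → F (c x) x = F i x := by
      intro i x hx
      obtain ⟨k, hik, hck⟩ := hdir i (c x)
      rw [← hcomp i k hik x hx, hcomp (c x) k hck x (hc x)]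
    have hpair : ∀ x y : B, ∃ k, e k * x * e k = x ∧ e k * y * e k = y := fun x y =>
      let ⟨k, hx, hy⟩ := hdir (c x) (c y)
      ⟨k, hcorner hx (hc x), hcorner hy (hc y)⟩
    refine ⟨⟨⟨fun x => F (c x) x, fun x y => ?_⟩, fun a x => ?_⟩, fun x y => ?_, hval⟩
    · obtain ⟨k, hx, hy⟩ := hpair x y
      rw [hval k x hx, hval k y hy, hval k (x + y) (by rw [mul_add, add_mul, hx, hy]), map_add]
    · have hax : e (c x) * (a • x) * e (c x) = a • x := by
        rw [mul_smul_comm, smul_mul_assoc, hc x]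
      simp only [hval (c x) (a • x) hax, map_smul, RingHom.id_apply]
    · obtain ⟨k, hx, hy⟩ := hpair x y
      have hxy := corner_mul_mem (hidem k) hx hy
      simp only [LinearMap.coe_mk, AddHom.coe_mk, hval k x hx, hval k y hy, hval k (x * y) hxy]
      exact (hF k).2.2 x y hx hy
  · rw [LinearMap.add_comp, LinearMap.comp_add]
  · ext x
    have h := corner_map_mem (hidem i) (fun x y _ _ => hτ' x y) (corner_compress_mem (hidem i) x)
    simp only [LinearMap.comp_apply, cornerCompress_apply, h]
end

section
/- Let E = (E⁰, E¹, s, r) be a directed graph, H ⊆ E⁰ a hereditary subset, and v a vertex belonging to the hereditary and saturated closure of H but not to H. Then the set Π_{v,H} := {paths λ = f₁⋯f_n (n ≥ 1) : s(λ) = v, r(λ) ∈ H, and s(f_n) ∉ H} is finite. -/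
/-- A subset `H` of vertices of a graph with source and range maps `s r : E → V`
is hereditary if the range of every edge whose source is in `H` is also in `H`. -/
def IsHereditarySet {V E : Type*} (s r : E → V) (H : Set V) : Prop :=
  ∀ e : E, s e ∈ H → r e ∈ H

/-- The increasing sequence `Λⁿ(H)` whose union is the hereditary and saturated
closure of a hereditary set `H`: `Λ⁰(H) = H` and `Λ^{n+1}(H)` adds every regular
vertex all of whose emitted edges have range in `Λⁿ(H)`. -/
def satLevel {V E : Type*} (s r : E → V) (H : Set V) : ℕ → Set V
  | 0 => H
  | n + 1 => satLevel s r H n ∪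
      {v | {e : E | s e = v}.Finite ∧ {e : E | s e = v}.Nonempty ∧
        ∀ e : E, s e = v → r e ∈ satLevel s r H n}

/-- `Π_{v,H}`: the set of nontrivial paths `λ = f₁ ⋯ f_n` (encoded as nonempty lists
of composable edges) with source `v`, range in `H`, and such that the source of the
last edge is not in `H`. -/
def pathsToH {V E : Type*} (s r : E → V) (H : Set V) (v : V) : Set (List E) :=
  {p | List.Chain' (fun a b => r a = s b) p ∧
       (∃ f, p.head? = some f ∧ s f = v) ∧
       (∃ g, p.getLast? = some g ∧ r g ∈ H ∧ s g ∉ H)}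

theorem exists_cons_of_mem_pathsToH {V E : Type*} {s r : E → V} {H : Set V} {v : V}
    {p : List E} (hp : p ∈ pathsToH s r H v) :
    ∃ e, s e = v ∧ (p = [e] ∧ s e ∉ H ∨ ∃ q ∈ pathsToH s r H (r e), e :: q = p) := by
  obtain ⟨hc, ⟨f, hf, hfv⟩, g, hg, hgH, hgs⟩ := hp
  match p, hc, hf, hg with
  | [a], _, hf, hg =>
    simp only [List.head?_cons, Option.some.injEq, List.getLast?_singleton] at hf hg
    subst hf hg
    exact ⟨a, hfv, Or.inl ⟨rfl, hgs⟩⟩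
  | a :: b :: q, hc, hf, hg =>
    simp only [List.head?_cons, Option.some.injEq] at hf
    subst hf
    rw [List.getLast?_cons_cons] at hg
    have hc' := List.isChain_cons_cons.mp hc
    exact ⟨a, hfv, Or.inr ⟨b :: q, ⟨hc'.2, ⟨b, rfl, hc'.1.symm⟩, g, hg, hgH, hgs⟩, rfl⟩⟩

theorem IsHereditarySet.pathsToH_eq_empty {V E : Type*} {s r : E → V} {H : Set V}
    (hH : IsHereditarySet s r H) {v : V} (hv : v ∈ H) : pathsToH s r H v = ∅ := by
  refine Set.eq_empty_iff_forall_notMem.mpr fun p => ?_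
  induction p generalizing v with
  | nil => rintro ⟨-, ⟨f, hf, -⟩, -⟩; simp at hf
  | cons a p ih =>
    intro hp
    obtain ⟨e, rfl, ⟨-, he⟩ | ⟨q, hq, h⟩⟩ := exists_cons_of_mem_pathsToH hp
    · exact he hv
    · obtain ⟨rfl, rfl⟩ := List.cons.inj h
      exact ih (hH _ hv) hq

theorem IsHereditarySet.pathsToH_finite_of_mem_satLevel {V E : Type*} {s r : E → V} {H : Set V}
    (hH : IsHereditarySet s r H) {n : ℕ} {v : V} (hv : v ∈ satLevel s r H n) :
    (pathsToH s r H v).Finite := by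
  induction n generalizing v with
  | zero => rw [hH.pathsToH_eq_empty hv]; exact Set.finite_empty
  | succ n ih =>
    obtain hv | ⟨hfin, -, hr⟩ := hv
    · exact ih hv
    · refine (hfin.biUnion (t := fun e => {[e]} ∪ (e :: ·) '' pathsToH s r H (r e))
        fun e he => (Set.finite_singleton _).union ((ih (hr e he)).image _)).subset fun p hp => ?_
      obtain ⟨e, he, ⟨h, -⟩ | h⟩ := exists_cons_of_mem_pathsToH hp
      · exact Set.mem_biUnion he (Or.inl h)
      · exact Set.mem_biUnion he (Or.inr h)

/-- If `H` is hereditary and `v` belongs to the hereditary and saturated closure of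
`H` but not to `H`, then the set `Π_{v,H}` of paths from `v` to `H` whose last edge
starts outside `H` is finite. -/
theorem pathsToH_finite {V E : Type*} (s r : E → V) (H : Set V)
    (hH : IsHereditarySet s r H)
    (v : V) (hv : v ∈ ⋃ n : ℕ, satLevel s r H n) (hvH : v ∉ H) :
    (pathsToH s r H v).Finite := by
  obtain ⟨n, hn⟩ := Set.mem_iUnion.mp hv
  exact hH.pathsToH_finite_of_mem_satLevel hn
end
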